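/- For v ∈ W_m and w ∈ W_{m+n}, the Doob–Martin kernel with reference state the empty word, K(v,w) := (n-step transition probability from v to w)/((m+n)-step transition probability from the empty word to w), equals binom(w,v) · C(2m,m) / C(m+n,m)², where C denotes the usual binomial coefficient. -/

import Mathlib

open MeasureTheory ProbabilityTheory

/-- `W n`: words over `{a,b}` (with `true` playing the role of the letter `a` and
`false` the letter `b`) of length `2n` with exactly `n` letters `a`
(and hence `n` letters `b`). -/
def IsWord (n : ℕ) (w : Fin (2*n) → Bool) : Prop :=
  (Finset.univ.filter fun i => w i = true).card = n

instance (n : ℕ) : DecidablePred (IsWord n) := fun w =>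
  decidable_of_iff ((Finset.univ.filter fun i => w i = true).card = n) Iff.rfl

/-- `subwordCount w v` = number of occurrences of `v` as a subword of `w`:
the number of strictly increasing maps `f` from the index set of `v` to the
index set of `w` such that the letter of `w` at `f k` is the letter of `v` at `k`. -/
noncomputable def subwordCount {q p : ℕ} (w : Fin q → Bool) (v : Fin p → Bool) : ℕ :=
  Nat.card {f : Fin p → Fin q // StrictMono f ∧ ∀ k, w (f k) = v k}

/-- One-step transition probability of the growing word chain:
`P_m(v,w) = binom(w,v)/((2m+2)(2m+1))` for `v ∈ W_m`, `w ∈ W_{m+1}`. -/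
noncomputable def oneStep (m : ℕ) (v : Fin (2*m) → Bool) (w : Fin (2*(m+1)) → Bool) : ℝ :=
  subwordCount w v / ((2*m+2)*(2*m+1))

/-- `n`-step transition probability of the growing word chain from `v ∈ W_m` to
`w ∈ W_{m+n}`: the sum over all chains of intermediate words of the products of
one-step transition probabilities. -/
noncomputable def nStep (m : ℕ) : (n : ℕ) → (Fin (2*m) → Bool) → (Fin (2*(m+n)) → Bool) → ℝ
  | 0, v, w => if v = w then 1 else 0
  | n+1, v, w =>
      ∑ v' ∈ Finset.univ.filter (IsWord (m+n)),
        nStep m n v v' * oneStep (m+n) v' w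

/-- The empty word. -/
def emptyWord : Fin (2*0) → Bool := ![]

open Finset in
open scoped Classical in
theorem subwordCount_eq_card {q p : ℕ} (w : Fin q → Bool) (v : Fin p → Bool) :
    subwordCount w v = #{f : Fin p → Fin q | StrictMono f ∧ w ∘ f = v} := by
  rw [subwordCount, Nat.card_eq_fintype_card, Fintype.card_subtype]
  simp only [funext_iff, Function.comp_apply]

theorem subwordCount_self_length {p : ℕ} (w v : Fin p → Bool) :
    subwordCount w v = if v = w then 1 else 0 := by
  classical
  have hid : ∀ f : Fin p → Fin p, StrictMono f → f = id := fun f hf => by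
    rw [← StrictMono.range_inj hf strictMono_id, Set.range_id,
      (Finite.injective_iff_surjective.1 hf.injective).range_eq]
  rw [subwordCount_eq_card]
  split_ifs with h
  · rw [Finset.card_eq_one]
    refine ⟨id, Finset.ext fun f => ?_⟩
    simp only [Finset.mem_filter, Finset.mem_univ, true_and, Finset.mem_singleton]
    exact ⟨fun hf => hid f hf.1, fun hf => by subst hf; exact ⟨strictMono_id, h.symm⟩⟩
  · rw [Finset.card_eq_zero, Finset.filter_eq_empty_iff]
    rintro f - ⟨hf, hw⟩
    rw [hid f hf] at hw
    exact h hw.symm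

open Finset in
theorem IsWord.card_filter_eq {n : ℕ} {w : Fin (2 * n) → Bool} (hw : IsWord n w) (b : Bool) :
    #{i | w i = b} = n := by
  have h : #{i | w i = true} = n := hw
  have h2 := card_filter_add_card_filter_not (s := (univ : Finset (Fin (2 * n))))
    (fun i => w i = true)
  simp only [Bool.not_eq_true, card_univ, Fintype.card_fin] at h2
  cases b <;> omega

open Finset in
open scoped Classical in
theorem card_filter_notMem_range_add {k q : ℕ} (w : Fin q → Bool) {h : Fin k → Fin q}
    (hh : h.Injective) (b : Bool) :
    #{i | w i = b ∧ i ∉ Set.range h} + #{j | w (h j) = b} = #{i | w i = b} := by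
  rw [← card_image_of_injective {j | w (h j) = b} hh, ← card_union_of_disjoint]
  · congr 1
    ext i
    simp only [mem_union, mem_filter, mem_univ, true_and, mem_image, Set.mem_range]
    constructor
    · rintro (h1 | ⟨j, hj, rfl⟩)
      exacts [h1.1, hj]
    · intro hi
      by_cases hr : ∃ j, h j = i
      · obtain ⟨j, rfl⟩ := hr
        exact Or.inr ⟨j, hi, rfl⟩
      · exact Or.inl ⟨hi, hr⟩
  · rw [disjoint_left]
    simp only [mem_filter, mem_univ, true_and, mem_image, Set.mem_range]
    rintro i ⟨-, hi⟩ ⟨j, -, hj⟩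
    exact hi ⟨j, hj⟩

open Finset in
/-- Choosing a balanced subword of `w` one step below it containing a fixed occurrence amounts to the removal
of one letter of each kind from `w`, away from the occurrence. -/
theorem card_balanced_superoccurrences {m n : ℕ} {w : Fin (2 * (m + n + 1)) → Bool}
    (hw : IsWord (m + n + 1) w) {h : Fin (2 * m) → Fin (2 * (m + n + 1))} (hh : StrictMono h)
    (hv : IsWord m (w ∘ h)) [DecidablePred fun g : Fin (2 * (m + n)) → Fin (2 * (m + n + 1)) =>
      StrictMono g ∧ IsWord (m + n) (w ∘ g) ∧ Set.range h ⊆ Set.range g] :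
    #{g : Fin (2 * (m + n)) → Fin (2 * (m + n + 1)) |
      StrictMono g ∧ IsWord (m + n) (w ∘ g) ∧ Set.range h ⊆ Set.range g} = (n + 1) ^ 2 := by
  classical
  have hcard : ∀ b, #{i | w i = b ∧ i ∉ Set.range h} = n + 1 := fun b => by
    have h1 := card_filter_notMem_range_add w hh.injective b
    have h2 : #{j | w (h j) = b} = m := hv.card_filter_eq b
    have h3 := hw.card_filter_eq b
    omega
  have hne : ∀ i j, w i = true → w j = false → i ≠ j := by
    rintro i j hi hj rfl
    simp [hi] at hj
  have hpair : ∀ x ∈ ({i | w i = true ∧ i ∉ Set.range h} : Finset _) ×ˢ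
      ({i | w i = false ∧ i ∉ Set.range h} : Finset _),
      #({x.1, x.2}ᶜ : Finset (Fin (2 * (m + n + 1)))) = 2 * (m + n) := by
    rintro ⟨i, j⟩ hx
    simp only [mem_product, mem_filter, mem_univ, true_and] at hx
    rw [card_compl, card_pair (hne i j hx.1.1 hx.2.1), Fintype.card_fin]
    omega
  rw [sq]
  nth_rewrite 1 [← hcard true]
  rw [← hcard false, ← card_product]
  symm
  refine card_bij (fun x hx => (orderEmbOfFin _ (hpair x hx) : _ → _)) ?_ ?_ ?_
  · rintro ⟨i, j⟩ hx
    have hr := range_orderEmbOfFin _ (hpair _ hx)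
    have hg := (orderEmbOfFin _ (hpair _ hx)).strictMono
    generalize (orderEmbOfFin _ (hpair _ hx) : _ → _) = g at hr hg
    simp only [mem_product, mem_filter, mem_univ, true_and] at hx
    refine mem_filter.2 ⟨mem_univ _, hg, ?_, ?_⟩
    · have h1 := card_filter_notMem_range_add w hg.injective true
      rw [hw.card_filter_eq true] at h1
      have h2 : ({a | w a = true ∧ a ∉ Set.range g} : Finset _) = {i} := by
        ext a
        simp only [hr, coe_compl, mem_filter, mem_univ, true_and, Set.mem_compl_iff, not_not,
          mem_coe, mem_insert, mem_singleton]
        constructor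
        · rintro ⟨ha, rfl | rfl⟩
          · rfl
          · exact absurd rfl (hne _ _ ha hx.2.1)
        · rintro rfl
          exact ⟨hx.1.1, Or.inl rfl⟩
      rw [h2, card_singleton] at h1
      change #{k | w (g k) = true} = _
      omega
    · rw [hr]
      intro a ha
      simp only [coe_compl, Set.mem_compl_iff, mem_coe, mem_insert, mem_singleton]
      rintro (rfl | rfl)
      exacts [hx.1.2 ha, hx.2.2 ha]
  · rintro ⟨i, j⟩ hx ⟨i', j'⟩ hx' heq
    have hr := congrArg Set.range heq
    rw [range_orderEmbOfFin, range_orderEmbOfFin, coe_inj, compl_inj_iff] at hr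
    simp only [mem_product, mem_filter, mem_univ, true_and] at hx hx'
    have hi : i ∈ ({i', j'} : Finset _) := hr ▸ mem_insert_self _ _
    have hj : j ∈ ({i', j'} : Finset _) := hr ▸ mem_insert_of_mem (mem_singleton_self _)
    simp only [mem_insert, mem_singleton] at hi hj
    have h1 := hi.resolve_right (hne _ _ hx.1.1 hx'.2.1)
    have h2 := hj.resolve_left (hne _ _ hx'.1.1 hx.2.1).symm
    rw [h1, h2]
  · intro g hg
    obtain ⟨hg, hgw, hsub⟩ := (mem_filter.1 hg).2
    have hone : ∀ b, #{i | w i = b ∧ i ∉ Set.range g} = 1 := fun b => by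
      have h1 := card_filter_notMem_range_add w hg.injective b
      have h2 : #{j | w (g j) = b} = m + n := hgw.card_filter_eq b
      have h3 := hw.card_filter_eq b
      omega
    obtain ⟨i, hi⟩ := card_eq_one.1 (hone true)
    obtain ⟨j, hj⟩ := card_eq_one.1 (hone false)
    have hi' : w i = true ∧ i ∉ Set.range g := by
      simpa using (Finset.ext_iff.1 hi i).2 (mem_singleton_self _)
    have hj' : w j = false ∧ j ∉ Set.range g := by
      simpa using (Finset.ext_iff.1 hj j).2 (mem_singleton_self _)
    have hx : (i, j) ∈ ({i | w i = true ∧ i ∉ Set.range h} : Finset _) ×ˢ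
        ({i | w i = false ∧ i ∉ Set.range h} : Finset _) := by
      simp only [mem_product, mem_filter, mem_univ, true_and]
      exact ⟨⟨hi'.1, fun ha => hi'.2 (hsub ha)⟩, hj'.1, fun ha => hj'.2 (hsub ha)⟩
    refine ⟨(i, j), hx, (StrictMono.range_inj (orderEmbOfFin _ _).strictMono hg).1 ?_⟩
    rw [range_orderEmbOfFin]
    ext a
    simp only [coe_compl, Set.mem_compl_iff, mem_coe, mem_insert, mem_singleton]
    constructor
    · intro ha
      by_contra hr
      cases hb : w a
      · exact ha (Or.inr (mem_singleton.1 (hj ▸ mem_filter.2 ⟨mem_univ _, hb, hr⟩)))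
      · exact ha (Or.inl (mem_singleton.1 (hi ▸ mem_filter.2 ⟨mem_univ _, hb, hr⟩)))
    · rintro ha (rfl | rfl)
      exacts [hi'.2 ha, hj'.2 ha]

open Finset in
theorem sum_subwordCount_mul_subwordCount {m n : ℕ} {v : Fin (2 * m) → Bool}
    {w : Fin (2 * (m + n + 1)) → Bool} (hv : IsWord m v) (hw : IsWord (m + n + 1) w) :
    ∑ v' ∈ Finset.univ.filter (IsWord (m + n)), subwordCount v' v * subwordCount w v' =
      (n + 1) ^ 2 * subwordCount w v := by
  classical
  let P : Finset ((Fin (2 * m) → Fin (2 * (m + n))) ×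
      (Fin (2 * (m + n)) → Fin (2 * (m + n + 1)))) :=
    {x | StrictMono x.1 ∧ StrictMono x.2 ∧ IsWord (m + n) (w ∘ x.2) ∧ w ∘ x.2 ∘ x.1 = v}
  have h1 : #P = ∑ v' ∈ Finset.univ.filter (IsWord (m + n)),
      subwordCount v' v * subwordCount w v' := by
    rw [card_eq_sum_card_fiberwise (f := fun x => w ∘ x.2)
      (t := Finset.univ.filter (IsWord (m + n)))]
    · refine sum_congr rfl fun v' hv' => ?_
      rw [subwordCount_eq_card, subwordCount_eq_card, ← card_product]
      congr 1
      ext ⟨f, g⟩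
      simp only [P, mem_filter, mem_univ, true_and, mem_product] at hv' ⊢
      constructor
      · rintro ⟨⟨hf, hg, -, h⟩, rfl⟩
        exact ⟨⟨hf, h⟩, hg, rfl⟩
      · rintro ⟨⟨hf, h⟩, hg, rfl⟩
        exact ⟨⟨hf, hg, hv', h⟩, rfl⟩
    · intro x hx
      have hx := (mem_filter.1 hx).2
      simpa using hx.2.2.1
  rw [← h1, card_eq_sum_card_fiberwise (f := fun x => x.2 ∘ x.1)
      (t := {h : Fin (2 * m) → Fin (2 * (m + n + 1)) | StrictMono h ∧ w ∘ h = v}),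
      sum_const_nat (m := (n + 1) ^ 2), subwordCount_eq_card, mul_comm]
  · intro h hh
    obtain ⟨hh, hwh⟩ := (mem_filter.1 hh).2
    rw [← card_balanced_superoccurrences hw hh (hwh ▸ hv)]
    refine card_bij (fun x _ => x.2) ?_ ?_ ?_
    · rintro ⟨f, g⟩ hx
      simp only [P, mem_filter, mem_univ, true_and] at hx ⊢
      obtain ⟨⟨hf, hg, hgw, -⟩, rfl⟩ := hx
      exact ⟨hg, hgw, Set.range_comp_subset_range f g⟩
    · rintro ⟨f, g⟩ hx ⟨f', g'⟩ hx' hgg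
      simp only [P, mem_filter, mem_univ, true_and] at hx hx' hgg
      subst hgg
      rw [hx.1.2.1.injective.comp_left (hx.2.trans hx'.2.symm)]
    · intro g hg
      obtain ⟨hg, hgw, hsub⟩ := (mem_filter.1 hg).2
      choose f hf using fun k => hsub (Set.mem_range_self k)
      have hgf : g ∘ f = h := funext hf
      refine ⟨(f, g), ?_, rfl⟩
      simp only [P, mem_filter, mem_univ, true_and]
      refine ⟨⟨fun a b hab => ?_, hg, hgw, by rw [hgf, hwh]⟩, hgf⟩
      rw [← hg.lt_iff_lt, hf, hf]
      exact hh hab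
  · intro x hx
    have hx := (mem_filter.1 hx).2
    simpa using ⟨hx.2.1.comp hx.1, hx.2.2.2⟩

open Nat in
theorem nStep_eq {m : ℕ} {v : Fin (2 * m) → Bool} (hv : IsWord m v) (n : ℕ)
    (w : Fin (2 * (m + n)) → Bool) (hw : IsWord (m + n) w) :
    nStep m n v w = subwordCount w v * ((n ! : ℝ) ^ 2 * (2 * m)! / (2 * (m + n))!) := by
  induction n with
  | zero =>
    have h : subwordCount w v = if v = w then 1 else 0 := subwordCount_self_length (p := 2 * m) w v
    rw [nStep, h]
    have := Nat.factorial_ne_zero (2 * m)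
    split_ifs <;> simp [this]
  | succ n ih =>
    have hsum := congrArg (Nat.cast : ℕ → ℝ) (sum_subwordCount_mul_subwordCount hv hw)
    push_cast at hsum
    rw [nStep]
    calc _ = ∑ v' ∈ Finset.univ.filter (IsWord (m + n)),
          (subwordCount v' v * subwordCount w v' : ℝ) *
          (((n ! : ℝ) ^ 2 * (2 * m)! / (2 * (m + n))!) /
            ((2 * ((m + n : ℕ) : ℝ) + 2) * (2 * ((m + n : ℕ) : ℝ) + 1))) := by
          refine Finset.sum_congr rfl fun v' hv' => ?_
          rw [ih v' (Finset.mem_filter.1 hv').2, oneStep]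
          ring
      _ = _ := by
          rw [← Finset.sum_mul, hsum]
          have h2 : (2 * (m + (n + 1)))! =
              (2 * (m + n) + 2) * ((2 * (m + n) + 1) * (2 * (m + n))!) := by
            rw [show 2 * (m + (n + 1)) = 2 * (m + n) + 1 + 1 by ring, Nat.factorial_succ,
              Nat.factorial_succ]
          rw [h2, Nat.factorial_succ]
          have : ((2 * (m + n))! : ℝ) ≠ 0 := by positivity
          have : (2 * ((m : ℝ) + n) + 2) ≠ 0 := by positivity
          have : (2 * ((m : ℝ) + n) + 1) ≠ 0 := by positivity
          push_cast
          field_simp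

theorem subwordCount_of_isEmpty {q p : ℕ} [IsEmpty (Fin p)] (w : Fin q → Bool)
    (v : Fin p → Bool) : subwordCount w v = 1 := by
  rw [subwordCount, Nat.card_eq_one_iff_unique]
  exact ⟨⟨fun a b => Subtype.ext (Subsingleton.elim _ _)⟩,
    ⟨isEmptyElim, fun a => isEmptyElim a, fun a => isEmptyElim a⟩⟩

theorem IsWord.comp_cast {n k : ℕ} {w : Fin (2 * n) → Bool} (hw : IsWord n w) (h : k = n)
    (h' : 2 * k = 2 * n) : IsWord k (w ∘ Fin.cast h') := by
  subst h
  exact hw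

/-- For `v ∈ W_m` and `w ∈ W_{m+n}`, the Doob–Martin kernel with reference state the
empty word, `K(v,w) = (n-step prob from v to w)/((m+n)-step prob from ∅ to w)`, equals
`binom(w,v) · C(2m,m) / C(m+n,m)²`. -/
theorem doobMartinKernel_eq (m n : ℕ) (v : Fin (2*m) → Bool) (w : Fin (2*(m+n)) → Bool)
    (hv : IsWord m v) (hw : IsWord (m+n) w) :
    nStep m n v w
        / nStep 0 (m+n) emptyWord (w ∘ Fin.cast (show 2*(0+(m+n)) = 2*(m+n) by omega))
      = (subwordCount w v : ℝ) * ((2*m).choose m) / ((m+n).choose m)^2 := by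
  have hw' := hw.comp_cast (zero_add (m + n)) (by omega)
  have he : IsWord 0 emptyWord := rfl
  rw [nStep_eq hv n w hw, nStep_eq he (m + n) _ hw']
  have : IsEmpty (Fin (2 * 0)) := Fin.isEmpty
  have h0 : (2 * (0 + (m + n))).factorial = (2 * (m + n)).factorial := by rw [zero_add]
  have h1 : ((2 * m).choose m : ℝ) = (2 * m).factorial / (m.factorial * m.factorial) := by
    rw [two_mul, Nat.cast_add_choose ℝ]
  rw [subwordCount_of_isEmpty _ emptyWord, h0, Nat.cast_add_choose ℝ, h1]
  simp only [mul_zero, Nat.factorial_zero]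
  push_cast
  field_simp
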